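/- arXiv:2204.11805 — 3 statements merged into one kernel-verified Lean document; each statement's English description precedes it below -/
import Mathlib

section
/- A position (x,y) with x ≤ y is a P-position of the Queen Bee game if and only if either (x,y) = (0,0), or x > 0, y = 2x, and the 2-adic valuation of x is even (i.e., the binary representation of x ends in an even number of zeros). -/
/-- A legal move of the Queen Bee from `p` to `q`: the Manhattan distance to the corner
decreases, and the move is within a column or row, diagonal, or a diagonal move that
bounces perpendicularly off a side of the board. -/
def QueenBeeMove (p q : ℕ × ℕ) : Prop :=
  q.1 + q.2 < p.1 + p.2 ∧
    (q.1 = p.1 ∨ q.2 = p.2 ∨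
      ((p.1 : ℤ) - q.1 = (p.2 : ℤ) - q.2) ∨
      (p.1 ≤ p.2 ∧ q.2 = p.2 - p.1) ∨
      (p.2 ≤ p.1 ∧ q.1 = p.1 - p.2))

/-- P-positions of the Queen Bee game, defined by well-founded recursion on `x + y`:
a position is a P-position iff every legal move from it leads to a non-P-position. -/
def QueenBeePPos (p : ℕ × ℕ) : Prop :=
  ∀ q, QueenBeeMove p q → ¬ QueenBeePPos q
termination_by p.1 + p.2
decreasing_by exact ‹QueenBeeMove p q›.1

theorem even_padicValNat_two_mul_iff {n : ℕ} (hn : 0 < n) :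
    Even (padicValNat 2 (2 * n)) ↔ ¬ Even (padicValNat 2 n) := by
  rw [padicValNat.mul two_ne_zero hn.ne', padicValNat_self, add_comm, Nat.even_add_one]

theorem even_of_not_even_padicValNat {n : ℕ} (h : ¬ Even (padicValNat 2 n)) :
    ∃ m, n = 2 * m := by
  by_contra hn
  exact h (by rw [padicValNat.eq_zero_of_not_dvd hn]; exact Even.zero)

/-- The claimed set of P-positions, closed under exchanging the coordinates. -/
def IsDoublingPair (p : ℕ × ℕ) : Prop :=
  (p.1 = 0 ∧ p.2 = 0) ∨ (0 < p.1 ∧ p.2 = 2 * p.1 ∧ Even (padicValNat 2 p.1)) ∨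
    (0 < p.2 ∧ p.1 = 2 * p.2 ∧ Even (padicValNat 2 p.2))

theorem IsDoublingPair.swap {p : ℕ × ℕ} (h : IsDoublingPair p) : IsDoublingPair p.swap := by
  unfold IsDoublingPair at *
  simp only [Prod.fst_swap, Prod.snd_swap]
  tauto

theorem QueenBeeMove.swap {p q : ℕ × ℕ} (h : QueenBeeMove p q) :
    QueenBeeMove p.swap q.swap := by
  unfold QueenBeeMove at *
  simp only [Prod.fst_swap, Prod.snd_swap]
  omega

theorem IsDoublingPair.fst_unique {u v w : ℕ} (hu : IsDoublingPair (u, w))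
    (hv : IsDoublingPair (v, w)) : u = v := by
  simp only [IsDoublingPair] at hu hv
  rcases hu with hu | ⟨hu, rfl, hu'⟩ | hu <;> rcases hv with hv | ⟨hv, hw, hv'⟩ | hv
  any_goals omega
  · exact absurd hu' ((even_padicValNat_two_mul_iff hu).1 hv.2.2)
  · rw [hw] at hu
    exact absurd hv' ((even_padicValNat_two_mul_iff hv).1 hu.2.2)

theorem IsDoublingPair.snd_unique {u v w : ℕ} (hu : IsDoublingPair (w, u))
    (hv : IsDoublingPair (w, v)) : u = v :=
  hu.swap.fst_unique hv.swap

/-- Every positive row contains a doubling pair. -/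
theorem exists_isDoublingPair {d : ℕ} (hd : 0 < d) :
    ∃ u, IsDoublingPair (u, d) ∧ (u = 2 * d ∨ 2 * u = d) := by
  by_cases h : Even (padicValNat 2 d)
  · exact ⟨2 * d, Or.inr (Or.inr ⟨hd, rfl, h⟩), Or.inl rfl⟩
  · obtain ⟨m, rfl⟩ := even_of_not_even_padicValNat h
    have hm : 0 < m := by omega
    refine ⟨m, Or.inr (Or.inl ⟨hm, rfl, ?_⟩), Or.inr rfl⟩
    rwa [even_padicValNat_two_mul_iff hm, not_not] at h

theorem IsDoublingPair.not_of_move_of_le {x y u v : ℕ} (hxy : x ≤ y)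
    (h : IsDoublingPair (x, y)) (hm : QueenBeeMove (x, y) (u, v)) :
    ¬ IsDoublingPair (u, v) := by
  intro hq
  obtain ⟨hlt, hm⟩ := hm
  dsimp only at hlt hm
  rcases hm with rfl | rfl | hm | ⟨-, hm⟩ | hm
  · have := h.snd_unique hq
    omega
  · have := h.fst_unique hq
    omega
  · simp only [IsDoublingPair] at h hq
    omega
  · have hv : v = x := by
      simp only [IsDoublingPair] at h
      omega
    subst hv
    have := h.swap.fst_unique hq
    simp only at this
    omega
  · simp only [IsDoublingPair] at h
    omega

theorem IsDoublingPair.not_of_move {p q : ℕ × ℕ} (h : IsDoublingPair p)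
    (hm : QueenBeeMove p q) : ¬ IsDoublingPair q := by
  rcases le_total p.1 p.2 with hp | hp
  · exact h.not_of_move_of_le hp hm
  · exact fun hq => h.swap.not_of_move_of_le hp hm.swap hq.swap

theorem exists_move_isDoublingPair_of_le {x y : ℕ} (hxy : x ≤ y)
    (h : ¬ IsDoublingPair (x, y)) : ∃ q, QueenBeeMove (x, y) q ∧ IsDoublingPair q := by
  have h0 : ¬ (x = 0 ∧ y = 0) := fun h' => h (Or.inl h')
  by_cases hz : x = 0 ∨ x = y
  · exact ⟨(0, 0), by unfold QueenBeeMove; dsimp only; omega, Or.inl ⟨rfl, rfl⟩⟩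
  rcases lt_or_ge (2 * x) y with hy | hy
  · obtain ⟨v, hv, hvx⟩ := exists_isDoublingPair (d := x) (by omega)
    exact ⟨(x, v), by unfold QueenBeeMove; dsimp only; omega, hv.swap⟩
  · obtain ⟨u, hu, hud⟩ := exists_isDoublingPair (d := y - x) (by omega)
    have hne : u ≠ 2 * x := by
      rintro rfl
      have hyx : y = 2 * x := by omega
      have hd : y - x = x := by omega
      rw [hd] at hu
      exact h (hyx ▸ hu.swap)
    exact ⟨(u, y - x), by unfold QueenBeeMove; dsimp only; omega, hu⟩

theorem exists_move_isDoublingPair {p : ℕ × ℕ} (h : ¬ IsDoublingPair p) :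
    ∃ q, QueenBeeMove p q ∧ IsDoublingPair q := by
  rcases le_total p.1 p.2 with hp | hp
  · exact exists_move_isDoublingPair_of_le hp h
  · obtain ⟨q, hm, hq⟩ := exists_move_isDoublingPair_of_le (x := p.2) (y := p.1) hp
      (fun h' => h h'.swap)
    exact ⟨q.swap, hm.swap, hq.swap⟩

theorem queenBeePPos_iff_isDoublingPair (p : ℕ × ℕ) :
    QueenBeePPos p ↔ IsDoublingPair p := by
  induction hn : p.1 + p.2 using Nat.strong_induction_on generalizing p with
  | _ n ih =>
    subst hn
    rw [QueenBeePPos]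
    constructor
    · intro h
      by_contra hp
      obtain ⟨q, hm, hq⟩ := exists_move_isDoublingPair hp
      exact h q hm ((ih _ hm.1 q rfl).2 hq)
    · exact fun hp q hm hq => hp.not_of_move hm ((ih _ hm.1 q rfl).1 hq)

/-- A position `(x,y)` with `x ≤ y` is a P-position of the Queen Bee game iff it is
`(0,0)`, or `x > 0`, `y = 2x` and the 2-adic valuation of `x` is even. -/
theorem queenBee_ppos_iff (x y : ℕ) (hxy : x ≤ y) :
    QueenBeePPos (x, y) ↔
      (x = 0 ∧ y = 0) ∨ (0 < x ∧ y = 2 * x ∧ Even (padicValNat 2 x)) := by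
  rw [queenBeePPos_iff_isDoublingPair, IsDoublingPair]
  dsimp only
  have hyx : ¬ (0 < y ∧ x = 2 * y ∧ Even (padicValNat 2 y)) := by omega
  tauto
end

section
/- Let κ be the coding on {a,b,c} given by κ(a) = a, κ(b) = ac, κ(c) = a, applied letterwise to infinite words (concatenating the images). Then κ(t) = t_b: applying κ to the Tribonacci word t yields exactly the infinite word obtained from t by deleting all occurrences of the letter b. -/
inductive ABC : Type | A | B | C
  deriving DecidableEq

/-- The Tribonacci substitution `τ(a) = ab`, `τ(b) = ac`, `τ(c) = a`. -/
def τ : ABC → List ABC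
  | .A => [.A, .B]
  | .B => [.A, .C]
  | .C => [.A]

/-- The `n`-th iterate `τⁿ(a)`. -/
def tribIter (n : ℕ) : List ABC := (fun l => l.flatMap τ)^[n] [ABC.A]

/-- The Tribonacci word `t = abacabaabacab⋯` (0-indexed), the unique fixed point of `τ`
beginning with `a`; since `τⁿ⁺¹(a)` has length greater than `n` and each `τⁿ(a)` is a
prefix of `τⁿ⁺¹(a)`, its `n`-th letter is the `n`-th letter of `τⁿ⁺¹(a)`. -/
def trib (n : ℕ) : ABC := (tribIter (n + 1)).getD n ABC.A

/-- The infinite word (0-indexed) obtained from the Tribonacci word by deleting all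
occurrences of the letter `x`. -/
noncomputable def tribDel (x : ABC) (n : ℕ) : ABC :=
  trib (Nat.nth (fun i => trib i ≠ x) n)

/-- The coding `κ(a) = a`, `κ(b) = ac`, `κ(c) = a`. -/
def κ : ABC → List ABC
  | .A => [.A]
  | .B => [.A, .C]
  | .C => [.A]

theorem flatMap_prefix_flatMap {α β : Type*} {l₁ l₂ : List α} (f : α → List β)
    (h : l₁ <+: l₂) : l₁.flatMap f <+: l₂.flatMap f := by
  obtain ⟨r, rfl⟩ := h
  exact ⟨r.flatMap f, List.flatMap_append.symm⟩

theorem map_range_filter_eq_map_nth {α : Type*} (f : ℕ → α) (p : α → Prop) [DecidablePred p]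
    (M : ℕ) :
    ((List.range M).map f).filter p =
      (List.range (Nat.count (fun i => p (f i)) M)).map
        (fun n => f (Nat.nth (fun i => p (f i)) n)) := by
  induction M with
  | zero => simp
  | succ M ih =>
    rw [List.range_succ, List.map_append, List.filter_append, ih, Nat.count_succ]
    by_cases h : p (f M)
    · simp [h, List.range_succ, Nat.nth_count (p := fun i => p (f i)) h]
    · simp [h]

theorem tribIter_succ (n : ℕ) : tribIter (n + 1) = (tribIter n).flatMap τ :=
  Function.iterate_succ_apply' _ _ _

theorem tribIter_prefix_succ (n : ℕ) : tribIter n <+: tribIter (n + 1) := by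
  induction n with
  | zero => exact ⟨[ABC.B], rfl⟩
  | succ n ih =>
    rw [tribIter_succ n, tribIter_succ (n + 1)]
    exact flatMap_prefix_flatMap τ ih

theorem tribIter_prefix {m n : ℕ} (h : m ≤ n) : tribIter m <+: tribIter n := by
  induction n, h using Nat.le_induction with
  | base => exact List.prefix_rfl
  | succ n _ ih => exact ih.trans (tribIter_prefix_succ n)

theorem length_le_length_flatMap_τ (l : List ABC) : l.length ≤ (l.flatMap τ).length := by
  induction l with
  | nil => simp
  | cons x l ih =>
    rw [List.flatMap_cons, List.length_append, List.length_cons]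
    cases x <;> simp only [τ, List.length_cons] <;> omega

theorem lt_length_tribIter (n : ℕ) : n < (tribIter n).length := by
  induction n with
  | zero => simp [tribIter]
  | succ n ih =>
    obtain ⟨r, hr⟩ := tribIter_prefix (Nat.zero_le n)
    have h := length_le_length_flatMap_τ r
    have hA : tribIter 0 ++ r = ABC.A :: r := rfl
    rw [hA] at hr
    rw [← hr, List.length_cons] at ih
    rw [tribIter_succ, ← hr, List.flatMap_cons, List.length_append]
    simp only [τ, List.length_cons]
    omega

theorem getElem_tribIter {m i : ℕ} (h : i < (tribIter m).length) : (tribIter m)[i] = trib i := by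
  have hi : i < (tribIter (i + 1)).length := (Nat.lt_succ_self i).trans (lt_length_tribIter _)
  rw [trib, List.getD_eq_getElem _ _ hi]
  rcases le_total m (i + 1) with hm | hm
  · exact (tribIter_prefix hm).getElem h
  · exact ((tribIter_prefix hm).getElem hi).symm

theorem eq_map_trib_of_prefix {l : List ABC} {m : ℕ} (h : l <+: tribIter m) :
    l = (List.range l.length).map trib := by
  refine List.ext_getElem (by simp) fun i hi _ => ?_
  rw [h.getElem hi, getElem_tribIter]
  simp

theorem map_trib_prefix_tribIter (N : ℕ) : (List.range N).map trib <+: tribIter N := by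
  have h := lt_length_tribIter N
  rw [List.prefix_iff_eq_take]
  refine List.ext_getElem (by simp; omega) fun i _ _ => ?_
  simp [getElem_tribIter]

theorem flatMap_κ_eq_filter (l : List ABC) :
    l.flatMap κ = (l.flatMap τ).filter (· ≠ ABC.B) := by
  induction l with
  | nil => rfl
  | cons x l ih =>
    rw [List.flatMap_cons, List.flatMap_cons, List.filter_append, ih]
    cases x <;> rfl

/-- `κ(t) = t_b`: applying `κ` letterwise to the Tribonacci word `t` yields the word
obtained from `t` by deleting all `b`'s.  Formally: for every `N`, the image under `κ`
of the length-`N` prefix of `t` is a prefix of `t_b` (of the appropriate length); since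
these lengths are unbounded, this says exactly that the infinite word `κ(t)` is `t_b`. -/
theorem kappa_trib_eq_tribDelB :
    ∀ N : ℕ, ((List.range N).map trib).flatMap κ =
      (List.range (((List.range N).map trib).flatMap κ).length).map (tribDel ABC.B) := by
  intro N
  have h := flatMap_prefix_flatMap τ (map_trib_prefix_tribIter N)
  rw [← tribIter_succ] at h
  have key := map_range_filter_eq_map_nth trib (· ≠ ABC.B)
    (((List.range N).map trib).flatMap τ).length
  rw [← eq_map_trib_of_prefix h, ← flatMap_κ_eq_filter] at key
  have hlen := congrArg List.length key
  rw [List.length_map, List.length_range] at hlen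
  rw [hlen]
  exact key
end

section
/- For every n ≥ 1, either a_{b_n} = a_n + b_n or a_{b_n} = a_n + b_n − 1. (The coordinate sums of the P-positions of Corner the 2-Queen Dee satisfy Equation (1) of the paper.) -/
/-- `mex S` : the least natural number not in `S`. -/
noncomputable def mex (S : Set ℕ) : ℕ := sInf {m : ℕ | m ∉ S}

/-- `mex₂ S` : the least positive even integer not in `S`. -/
noncomputable def mex₂ (S : Set ℕ) : ℕ := sInf {m : ℕ | 0 < m ∧ Even m ∧ m ∉ S}

/-- The P-positions `(aₙ, bₙ)` of Corner the 2-Queen Dee: `(a₀,b₀) = (0,0)`,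
`a_{n+1} = mex({aᵢ : i ≤ n} ∪ {bᵢ : i ≤ n})` and
`b_{n+1} = a_{n+1} + mex₂({bᵢ − aᵢ : i ≤ n} ∪ {bᵢ + aᵢ : i ≤ n})`. -/
noncomputable def qdee : ℕ → ℕ × ℕ
  | 0 => (0, 0)
  | n + 1 =>
      let A : ℕ := mex ({m | ∃ i, ∃ _ : i ≤ n, m = (qdee i).1} ∪
        {m | ∃ i, ∃ _ : i ≤ n, m = (qdee i).2})
      let D : ℕ := mex₂ ({m | ∃ i, ∃ _ : i ≤ n, m = (qdee i).2 - (qdee i).1} ∪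
        {m | ∃ i, ∃ _ : i ≤ n, m = (qdee i).2 + (qdee i).1})
      (A, A + D)
termination_by n => n
decreasing_by all_goals omega

/-! ### The Tribonacci word, described through its finite prefixes -/

/-- The Tribonacci morphism `0 ↦ 01, 1 ↦ 02, 2 ↦ 0`. -/
def tribMorph : Fin 3 → List (Fin 3) := ![[0, 1], [0, 2], [0]]

/-- The Tribonacci morphism extended to words. -/
def tribSubst (w : List (Fin 3)) : List (Fin 3) := w.flatMap tribMorph

/-- `w` is a finite prefix of the Tribonacci word. -/
def IsTribPrefix (w : List (Fin 3)) : Prop := ∃ n, w <+: tribSubst^[n] [0]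

lemma tribSubst_append (u v : List (Fin 3)) :
    tribSubst (u ++ v) = tribSubst u ++ tribSubst v := by
  simp [tribSubst]

lemma tribSubst_prefix {u v : List (Fin 3)} (h : u <+: v) : tribSubst u <+: tribSubst v := by
  obtain ⟨t, rfl⟩ := h
  exact ⟨tribSubst t, (tribSubst_append u t).symm⟩

lemma count_tribSubst (w : List (Fin 3)) :
    (tribSubst w).count 0 = w.count 0 + w.count 1 + w.count 2 ∧
    (tribSubst w).count 1 = w.count 0 ∧ (tribSubst w).count 2 = w.count 1 := by
  induction w with
  | nil => simp [tribSubst]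
  | cons c w ih =>
    have h : tribSubst (c :: w) = tribMorph c ++ tribSubst w := by simp [tribSubst]
    rw [h]
    fin_cases c <;> simp [tribMorph, ih] <;> omega

lemma length_eq_count (w : List (Fin 3)) :
    w.length = w.count 0 + w.count 1 + w.count 2 := by
  induction w with
  | nil => simp
  | cons c w ih => fin_cases c <;> simp [ih] <;> omega

lemma IsTribPrefix.of_prefix {u v : List (Fin 3)} (hv : IsTribPrefix v) (h : u <+: v) :
    IsTribPrefix u := by
  obtain ⟨n, hn⟩ := hv
  exact ⟨n, h.trans hn⟩

lemma IsTribPrefix.tribSubst {u : List (Fin 3)} (hu : IsTribPrefix u) :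
    IsTribPrefix (tribSubst u) := by
  obtain ⟨n, hn⟩ := hu
  refine ⟨n + 1, ?_⟩
  rw [Function.iterate_succ_apply']
  exact tribSubst_prefix hn

lemma tribSubst_iterate_prefix_succ (n : ℕ) : tribSubst^[n] [0] <+: tribSubst^[n + 1] [0] := by
  induction n with
  | zero => exact ⟨[1], rfl⟩
  | succ n ih =>
    rw [Function.iterate_succ_apply', Function.iterate_succ_apply' _ (n + 1)]
    exact tribSubst_prefix ih

lemma tribSubst_iterate_prefix {m n : ℕ} (h : m ≤ n) :
    tribSubst^[m] [0] <+: tribSubst^[n] [0] := by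
  induction n, h using Nat.le_induction with
  | base => exact List.prefix_refl _
  | succ n _ ih => exact ih.trans (tribSubst_iterate_prefix_succ n)

lemma one_le_count_zero_iterate (n : ℕ) : 1 ≤ (tribSubst^[n] [0]).count 0 := by
  have h := (tribSubst_iterate_prefix (Nat.zero_le n)).sublist.count_le 0
  simpa using h

lemma lt_length_iterate (n : ℕ) : n < (tribSubst^[n] [0]).length := by
  induction n with
  | zero => simp
  | succ n ih =>
    have h0 := one_le_count_zero_iterate n
    have h1 := count_tribSubst (tribSubst^[n] [0])
    rw [length_eq_count] at ih
    rw [Function.iterate_succ_apply', length_eq_count]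
    omega

/-- The prefix of length `n` of the Tribonacci word. -/
def tribPrefix (n : ℕ) : List (Fin 3) := (tribSubst^[n] [0]).take n

lemma length_tribPrefix (n : ℕ) : (tribPrefix n).length = n := by
  have := lt_length_iterate n
  simp [tribPrefix]; omega

lemma isTribPrefix_tribPrefix (n : ℕ) : IsTribPrefix (tribPrefix n) :=
  ⟨n, List.take_prefix _ _⟩

lemma IsTribPrefix.eq_of_length_eq {u v : List (Fin 3)} (hu : IsTribPrefix u)
    (hv : IsTribPrefix v) (h : u.length = v.length) : u = v := by
  obtain ⟨m, hm⟩ := hu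
  obtain ⟨n, hn⟩ := hv
  have hm' := hm.trans (tribSubst_iterate_prefix (le_max_left m n))
  have hn' := hn.trans (tribSubst_iterate_prefix (le_max_right m n))
  exact (List.prefix_of_prefix_length_le hm' hn' h.le).eq_of_length h

lemma IsTribPrefix.eq_tribPrefix {u : List (Fin 3)} (hu : IsTribPrefix u) :
    tribPrefix u.length = u :=
  (isTribPrefix_tribPrefix _).eq_of_length_eq hu (length_tribPrefix _)

lemma exists_tribPrefix_succ (n : ℕ) : ∃ c, tribPrefix (n + 1) = tribPrefix n ++ [c] := by
  have hl := length_tribPrefix (n + 1)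
  have hne : tribPrefix (n + 1) ≠ [] := by
    intro h; simp [h] at hl
  have hd := List.dropLast_append_getLast hne
  refine ⟨(tribPrefix (n + 1)).getLast hne, ?_⟩
  have h1 : (tribPrefix (n + 1)).dropLast = tribPrefix n := by
    apply ((isTribPrefix_tribPrefix _).of_prefix (List.dropLast_prefix _)).eq_of_length_eq
      (isTribPrefix_tribPrefix n)
    simp [length_tribPrefix]
  rw [← h1, hd]

lemma IsTribPrefix.tribPrefix_succ {u : List (Fin 3)} {c : Fin 3} (h : IsTribPrefix (u ++ [c])) :
    tribPrefix (u.length + 1) = tribPrefix u.length ++ [c] := by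
  have h1 := h.eq_tribPrefix
  rw [(h.of_prefix (List.prefix_append _ _)).eq_tribPrefix, ← h1]
  simp

lemma exists_of_append_singleton_prefix_flatMap {α β : Type*} (f : α → List β) (w : List α)
    (u : List β) (c : β) (h : u ++ [c] <+: w.flatMap f) :
    ∃ u' c' s, u' ++ [c'] <+: w ∧ u = u'.flatMap f ++ s ∧ s ++ [c] <+: f c' := by
  induction w generalizing u with
  | nil => simp at h
  | cons a w ih =>
    rw [List.flatMap_cons] at h
    by_cases hl : u.length < (f a).length
    · refine ⟨[], a, u, by simp, by simp, ?_⟩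
      exact List.prefix_of_prefix_length_le h (List.prefix_append _ _) (by simp; omega)
    · obtain ⟨v, rfl⟩ : f a <+: u :=
        List.prefix_of_prefix_length_le (List.prefix_append _ _)
          ((List.prefix_append u [c]).trans h) (by omega)
      rw [List.append_assoc, List.prefix_append_right_inj] at h
      obtain ⟨u', c', s, h1, h2, h3⟩ := ih v h
      refine ⟨a :: u', c', s, ?_, ?_, h3⟩
      · simpa using h1
      · simp [h2]

lemma exists_desubstitution {n : ℕ} {u : List (Fin 3)} {c : Fin 3}
    (h : u ++ [c] <+: tribSubst^[n + 1] [0]) :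
    ∃ u' c' s, u' ++ [c'] <+: tribSubst^[n] [0] ∧ u = tribSubst u' ++ s ∧
      s ++ [c] <+: tribMorph c' := by
  rw [Function.iterate_succ_apply'] at h
  exact exists_of_append_singleton_prefix_flatMap tribMorph _ u c h

lemma IsTribPrefix.exists_desubstitution {u : List (Fin 3)} {c : Fin 3}
    (h : IsTribPrefix (u ++ [c])) :
    ∃ u' c' s, IsTribPrefix (u' ++ [c']) ∧ u = _root_.tribSubst u' ++ s ∧
      s ++ [c] <+: tribMorph c' := by
  obtain ⟨n, hn⟩ := h
  obtain ⟨u', c', s, h1, h2, h3⟩ :=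
    _root_.exists_desubstitution (hn.trans (tribSubst_iterate_prefix_succ n))
  exact ⟨u', c', s, ⟨n, h1⟩, h2, h3⟩

lemma append_singleton_prefix_tribMorph {s : List (Fin 3)} {c c' : Fin 3}
    (h : s ++ [c] <+: tribMorph c') :
    (s = [] ∧ c = 0) ∨ (s = [0] ∧ c = 1 ∧ c' = 0) ∨ (s = [0] ∧ c = 2 ∧ c' = 1) := by
  rcases s with _ | ⟨x, _ | ⟨y, s⟩⟩
  · fin_cases c' <;> simp_all [tribMorph]
  · fin_cases c' <;> simp_all [tribMorph]
  · have := h.length_le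
    fin_cases c' <;> simp [tribMorph] at this

lemma IsTribPrefix.exists_of_append_zero {u : List (Fin 3)} (h : IsTribPrefix (u ++ [0])) :
    ∃ u' c', IsTribPrefix (u' ++ [c']) ∧ u = _root_.tribSubst u' := by
  obtain ⟨u', c', s, h1, h2, h3⟩ := h.exists_desubstitution
  rcases append_singleton_prefix_tribMorph h3 with ⟨rfl, -⟩ | ⟨-, h, -⟩ | ⟨-, h, -⟩
  · exact ⟨u', c', h1, by simpa using h2⟩
  · simp at h
  · simp at h

lemma IsTribPrefix.exists_of_append_one {u : List (Fin 3)} (h : IsTribPrefix (u ++ [1])) :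
    ∃ u' c', IsTribPrefix (u' ++ [c']) ∧ u = _root_.tribSubst (_root_.tribSubst u') ++ [0] := by
  obtain ⟨u', c', s, h1, h2, h3⟩ := h.exists_desubstitution
  rcases append_singleton_prefix_tribMorph h3 with ⟨-, h⟩ | ⟨rfl, -, rfl⟩ | ⟨-, h, -⟩
  · simp at h
  · obtain ⟨v, d, hv, rfl⟩ := h1.exists_of_append_zero
    exact ⟨v, d, hv, h2⟩
  · simp at h

lemma tribSubst_singleton_prefix (c : Fin 3) : [0] <+: tribSubst [c] := by
  fin_cases c <;> simp [tribSubst, tribMorph]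

lemma IsTribPrefix.tribSubst_append_zero {u : List (Fin 3)} {c : Fin 3}
    (h : IsTribPrefix (u ++ [c])) : IsTribPrefix (_root_.tribSubst u ++ [0]) := by
  have h1 := h.tribSubst
  rw [_root_.tribSubst_append] at h1
  exact h1.of_prefix ((List.prefix_append_right_inj _).2 (tribSubst_singleton_prefix c))

lemma IsTribPrefix.tribSubst_tribSubst_append {u : List (Fin 3)} {c : Fin 3}
    (h : IsTribPrefix (u ++ [c])) :
    IsTribPrefix (_root_.tribSubst (_root_.tribSubst u) ++ [0] ++ [1]) := by
  have h1 := h.tribSubst_append_zero.tribSubst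
  rw [_root_.tribSubst_append] at h1
  simpa [_root_.tribSubst, tribMorph] using h1

/-! ### Closed forms for the coordinates, half-differences and half-sums -/

/-- `1 + k + |w|₁` for the Tribonacci prefix `w` of length `k`; this is `a_{k+1}`. -/
def tribA (k : ℕ) : ℕ := 1 + k + (tribPrefix k).count 1

/-- `3 + 3k + 2|w|₀ + |w|₁` for the Tribonacci prefix `w` of length `k`; this is `b_{k+1}`. -/
def tribB (k : ℕ) : ℕ := 3 + 3 * k + 2 * (tribPrefix k).count 0 + (tribPrefix k).count 1

/-- Half of `b_{k+1} - a_{k+1}`. -/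
def tribD (k : ℕ) : ℕ := 1 + k + (tribPrefix k).count 0

/-- Half of `b_{k+1} + a_{k+1}`. -/
def tribS (k : ℕ) : ℕ := 2 + 2 * k + (tribPrefix k).count 0 + (tribPrefix k).count 1

/-- `f` starts at `1` and has gaps `1` and `2`, and `g` enumerates the values `f` skips. -/
structure FillsGaps (f g : ℕ → ℕ) : Prop where
  zero : f 0 = 1
  step : ∀ k, f (k + 1) = f k + 1 ∨ (f (k + 1) = f k + 2 ∧ ∃ j, g j = f k + 1)
  gap : ∀ j, ∃ k, g j = f k + 1 ∧ f (k + 1) = f k + 2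

namespace FillsGaps

variable {f g : ℕ → ℕ}

lemma strictMono (h : FillsGaps f g) : StrictMono f := by
  refine strictMono_nat_of_lt_succ fun k => ?_
  rcases h.step k with h | h <;> omega

lemma ne (h : FillsGaps f g) (i j : ℕ) : f i ≠ g j := by
  intro hij
  obtain ⟨k, h1, h2⟩ := h.gap j
  have h3 : k < i := h.strictMono.lt_iff_lt.1 (by omega)
  have h4 : i < k + 1 := h.strictMono.lt_iff_lt.1 (by omega)
  omega

lemma cover (h : FillsGaps f g) {m : ℕ} (hm : 1 ≤ m) : (∃ i, f i = m) ∨ ∃ j, g j = m := by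
  induction m, hm using Nat.le_induction with
  | base => exact Or.inl ⟨0, h.zero⟩
  | succ m _ ih =>
    rcases ih with ⟨i, rfl⟩ | ⟨j, rfl⟩
    · rcases h.step i with h1 | ⟨-, h1⟩
      · exact Or.inl ⟨_, h1⟩
      · exact Or.inr h1
    · obtain ⟨k, h1, h2⟩ := h.gap j
      exact Or.inl ⟨k + 1, by omega⟩

end FillsGaps

lemma tribA_fillsGaps : FillsGaps tribA tribB where
  zero := by simp [tribA, tribPrefix]
  step k := by
    obtain ⟨c, hc⟩ := exists_tribPrefix_succ k
    by_cases h : c = 1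
    · subst h
      refine Or.inr ⟨by simp [tribA, hc]; omega, ?_⟩
      have h1 := isTribPrefix_tribPrefix (k + 1)
      rw [hc] at h1
      obtain ⟨u, d, hu, h2⟩ := h1.exists_of_append_one
      refine ⟨u.length, ?_⟩
      have hl := length_tribPrefix k
      have := length_eq_count u
      have := count_tribSubst u
      have := count_tribSubst (tribSubst u)
      rw [h2, length_eq_count] at hl
      simp only [tribA, tribB, (hu.of_prefix (List.prefix_append _ _)).eq_tribPrefix, h2]
      simp at hl ⊢
      omega
    · refine Or.inl ?_
      simp [tribA, hc, h]; omega
  gap j := by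
    obtain ⟨c, hc⟩ := exists_tribPrefix_succ j
    have h1 := isTribPrefix_tribPrefix (j + 1)
    rw [hc] at h1
    have h2 := h1.tribSubst_tribSubst_append
    set u := tribPrefix j with hu
    refine ⟨(tribSubst (tribSubst u) ++ [0]).length, ?_⟩
    have hl := length_tribPrefix j
    rw [← hu, length_eq_count] at hl
    have := count_tribSubst u
    have := count_tribSubst (tribSubst u)
    have hs := length_eq_count (tribSubst (tribSubst u))
    simp only [tribA, tribB, h2.tribPrefix_succ,
      (h2.of_prefix (List.prefix_append _ _)).eq_tribPrefix, ← hu]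
    simp [hs]
    omega

lemma tribD_fillsGaps : FillsGaps tribD tribS where
  zero := by simp [tribD, tribPrefix]
  step k := by
    obtain ⟨c, hc⟩ := exists_tribPrefix_succ k
    by_cases h : c = 0
    · subst h
      refine Or.inr ⟨by simp [tribD, hc]; omega, ?_⟩
      have h1 := isTribPrefix_tribPrefix (k + 1)
      rw [hc] at h1
      obtain ⟨u, d, hu, h2⟩ := h1.exists_of_append_zero
      refine ⟨u.length, ?_⟩
      have hl := length_tribPrefix k
      have := length_eq_count u
      have := count_tribSubst u
      rw [h2, length_eq_count] at hl
      simp only [tribD, tribS, (hu.of_prefix (List.prefix_append _ _)).eq_tribPrefix, h2]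
      omega
    · refine Or.inl ?_
      simp [tribD, hc, h]; omega
  gap j := by
    obtain ⟨c, hc⟩ := exists_tribPrefix_succ j
    have h1 := isTribPrefix_tribPrefix (j + 1)
    rw [hc] at h1
    have h2 := h1.tribSubst_append_zero
    set u := tribPrefix j with hu
    refine ⟨(tribSubst u).length, ?_⟩
    have hl := length_tribPrefix j
    rw [← hu, length_eq_count] at hl
    have := count_tribSubst u
    have hs := length_eq_count (tribSubst u)
    simp only [tribD, tribS, h2.tribPrefix_succ,
      (h2.of_prefix (List.prefix_append _ _)).eq_tribPrefix, ← hu]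
    simp [hs]
    omega

lemma tribB_eq (k : ℕ) : tribB k = tribA k + 2 * tribD k := by
  simp only [tribA, tribB, tribD]; omega

lemma tribB_add_tribA (k : ℕ) : tribB k + tribA k = 2 * tribS k := by
  simp only [tribA, tribB, tribS]; omega

lemma tribD_lt_tribS (k : ℕ) : tribD k < tribS k := by
  simp only [tribD, tribS]; omega

lemma mex_eq {S : Set ℕ} {v : ℕ} (hv : v ∉ S) (h : ∀ m < v, m ∈ S) : mex S = v :=
  IsLeast.csInf_eq ⟨hv, fun m hm => by by_contra hlt; exact hm (h m (by omega))⟩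

lemma mex₂_eq {S : Set ℕ} {v : ℕ} (hpos : 0 < v) (hv : 2 * v ∉ S)
    (h : ∀ m, 0 < m → m < v → 2 * m ∈ S) : mex₂ S = 2 * v := by
  refine IsLeast.csInf_eq ⟨⟨by omega, even_two_mul v, hv⟩, ?_⟩
  rintro m ⟨h0, he, hm⟩
  obtain ⟨r, rfl⟩ := he.two_dvd
  by_contra hlt
  exact hm (h r (by omega) (by omega))

lemma qdee_zero : qdee 0 = (0, 0) := by
  rw [qdee]

lemma qdee_succ (k : ℕ) : qdee (k + 1) = (tribA k, tribB k) := by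
  induction k using Nat.strong_induction_on with
  | _ k ih =>
  have hA : mex ({m | ∃ i, ∃ _ : i ≤ k, m = (qdee i).1} ∪
      {m | ∃ i, ∃ _ : i ≤ k, m = (qdee i).2}) = tribA k := by
    have hpos : 0 < tribA k := by simp only [tribA]; omega
    apply mex_eq
    · rintro (⟨_ | i, hi, h⟩ | ⟨_ | i, hi, h⟩)
      · simp [qdee_zero] at h; omega
      · rw [ih i (by omega)] at h
        have := tribA_fillsGaps.strictMono.injective h
        omega
      · simp [qdee_zero] at h; omega
      · rw [ih i (by omega)] at h
        exact tribA_fillsGaps.ne _ _ h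
    · intro m hm
      rcases Nat.eq_zero_or_pos m with rfl | h0
      · exact Or.inl ⟨0, Nat.zero_le _, by simp [qdee_zero]⟩
      rcases tribA_fillsGaps.cover h0 with ⟨i, rfl⟩ | ⟨j, rfl⟩
      · have hi : i < k := tribA_fillsGaps.strictMono.lt_iff_lt.1 hm
        exact Or.inl ⟨i + 1, hi, by rw [ih i hi]⟩
      · have hj : j < k := tribA_fillsGaps.strictMono.lt_iff_lt.1
          (lt_of_le_of_lt (by rw [tribB_eq]; omega) hm)
        exact Or.inr ⟨j + 1, hj, by rw [ih j hj]⟩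
  have hD : mex₂ ({m | ∃ i, ∃ _ : i ≤ k, m = (qdee i).2 - (qdee i).1} ∪
      {m | ∃ i, ∃ _ : i ≤ k, m = (qdee i).2 + (qdee i).1}) = 2 * tribD k := by
    have hpos : 0 < tribD k := by simp only [tribD]; omega
    apply mex₂_eq hpos
    · rintro (⟨_ | i, hi, h⟩ | ⟨_ | i, hi, h⟩)
      · simp [qdee_zero] at h; omega
      · rw [ih i (by omega)] at h
        have := tribB_eq i
        have : tribD k = tribD i := by simp only at h; omega
        have := tribD_fillsGaps.strictMono.injective this
        omega
      · simp [qdee_zero] at h; omega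
      · rw [ih i (by omega)] at h
        have := tribB_add_tribA i
        exact tribD_fillsGaps.ne k i (by simp only at h; omega)
    · intro m h0 hm
      rcases tribD_fillsGaps.cover h0 with ⟨i, rfl⟩ | ⟨j, rfl⟩
      · have hi : i < k := tribD_fillsGaps.strictMono.lt_iff_lt.1 hm
        exact Or.inl ⟨i + 1, hi, by rw [ih i hi, tribB_eq]; simp⟩
      · have hj : j < k := tribD_fillsGaps.strictMono.lt_iff_lt.1 ((tribD_lt_tribS j).trans hm)
        exact Or.inr ⟨j + 1, hj, by rw [ih j hj, ← tribB_add_tribA]⟩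
  rw [qdee]
  simp only [hA, hD, tribB_eq]

/-! ### Comparing the Tribonacci prefix of length `b_{k+1} - 1` with that of length `k` -/

/-- The abelianized Tribonacci morphism. -/
def tribMat (v : ℤ × ℤ × ℤ) : ℤ × ℤ × ℤ := (v.1 + v.2.1 + v.2.2, v.1, v.2.1)

/-- The map `M² + 1`, where `M` is the abelianized Tribonacci morphism. -/
def tribBlock (v : ℤ × ℤ × ℤ) : ℤ × ℤ × ℤ := tribMat (tribMat v) + v

/-- The vector of letter counts of a word. -/
def parikh (w : List (Fin 3)) : ℤ × ℤ × ℤ := (w.count 0, w.count 1, w.count 2)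

lemma parikh_append (u v : List (Fin 3)) : parikh (u ++ v) = parikh u + parikh v := by
  simp [parikh]

lemma parikh_tribSubst (u : List (Fin 3)) : parikh (tribSubst u) = tribMat (parikh u) := by
  obtain ⟨h0, h1, h2⟩ := count_tribSubst u
  simp [parikh, tribMat, h0, h1, h2]

lemma tribMat_add (u v : ℤ × ℤ × ℤ) : tribMat (u + v) = tribMat u + tribMat v := by
  ext <;> simp [tribMat]; ring

lemma tribBlock_add (u v : ℤ × ℤ × ℤ) : tribBlock (u + v) = tribBlock u + tribBlock v := by
  simp only [tribBlock, tribMat_add]; abel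

lemma tribMat_tribBlock (u : ℤ × ℤ × ℤ) : tribMat (tribBlock u) = tribBlock (tribMat u) := by
  simp only [tribBlock, tribMat_add]

/-- The triples `(c, v, W)` that arise from a nonempty Tribonacci prefix `u`, where `c` is the
letter following `u`, and the prefix of length `5|u|₀ + 4|u|₁ + 3|u|₂ - 1` has letter counts
`(M² + 1)|u| + v` and is followed by the word `W`. -/
def blockStates : List (Fin 3 × (ℤ × ℤ × ℤ) × List (Fin 3)) :=
  [(1, (-1, 0, 0), [0, 1, 0, 0, 1, 0]),
   (0, (0, -1, 0), [1, 0, 2, 0, 1, 0, 1]),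
   (2, (-1, 0, 0), [0, 1, 0, 2, 0]),
   (0, (0, 0, -1), [2, 0, 1, 0, 0, 1, 0]),
   (1, (0, 0, -1), [1, 0, 2, 0, 1, 0]),
   (0, (0, -1, 0), [1, 0, 2, 0, 1, 0, 0]),
   (0, (-1, 0, 0), [0, 0, 1, 0, 2, 0, 1]),
   (1, (-1, 0, 0), [0, 1, 0, 1, 0, 2]),
   (0, (-1, 0, 0), [0, 2, 0, 1, 0, 0, 1]),
   (0, (0, -1, 0), [1, 0, 1, 0, 2, 0, 1]),
   (0, (0, -1, 0), [1, 0, 2, 0, 1, 0, 2]),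
   (2, (-1, 0, 0), [0, 2, 0, 1, 0]),
   (0, (0, -1, 0), [1, 0, 0, 1, 0, 2, 0]),
   (1, (0, 0, -1), [2, 0, 1, 0, 1, 0]),
   (0, (0, 0, -1), [2, 0, 1, 0, 2, 0, 1]),
   (0, (0, 0, -1), [2, 0, 1, 0, 1, 0, 2]),
   (1, (-1, 1, -1), [0, 2, 0, 1, 0, 0]),
   (1, (-1, 0, 0), [0, 1, 0, 2, 0, 1]),
   (0, (-1, -1, 1), [0, 1, 0, 0, 1, 0, 2]),
   (2, (-1, 0, 0), [0, 0, 1, 0, 2]),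
   (0, (0, 0, -1), [0, 2, 0, 1, 0, 1, 0]),
   (0, (-1, 0, 0), [0, 1, 0, 0, 1, 0, 2]),
   (1, (-1, 1, -1), [0, 2, 0, 1, 0, 2])]

/-- Some Tribonacci prefix with letter counts `(M² + 1)|u| + v` is followed by the word `W`. -/
def HasWindow (u : List (Fin 3)) (v : ℤ × ℤ × ℤ) (W : List (Fin 3)) : Prop :=
  ∃ U, IsTribPrefix (U ++ W) ∧ parikh U = tribBlock (parikh u) + v

lemma HasWindow.tribSubst {u s : List (Fin 3)} {v v' : ℤ × ℤ × ℤ} {W W' : List (Fin 3)}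
    (h : HasWindow u v W) (j : ℕ) (hW : W' <+: (tribSubst W).drop j)
    (hv : tribMat v + parikh ((_root_.tribSubst W).take j) = tribBlock (parikh s) + v') :
    HasWindow (_root_.tribSubst u ++ s) v' W' := by
  obtain ⟨U, hU, hp⟩ := h
  refine ⟨_root_.tribSubst U ++ (_root_.tribSubst W).take j, ?_, ?_⟩
  · have h1 := hU.tribSubst
    rw [_root_.tribSubst_append, ← List.take_append_drop j (_root_.tribSubst W),
      ← List.append_assoc] at h1
    exact h1.of_prefix ((List.prefix_append_right_inj _).2 hW)
  · rw [parikh_append, parikh_append, parikh_tribSubst, parikh_tribSubst, hp, tribMat_add,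
      tribMat_tribBlock, tribBlock_add, add_assoc, hv, add_assoc]

/-- The states are closed under substitution: for each proper prefix `s` of the image of the
current letter, the next state is found by shifting the substituted window. -/
lemma blockStates_step : ∀ p ∈ blockStates,
    ∀ q ∈ [(([] : List (Fin 3)), (0 : Fin 3)), ([0], 1), ([0], 2)],
    q.1 ++ [q.2] <+: tribMorph p.1 → ∃ p' ∈ blockStates, p'.1 = q.2 ∧ ∃ j < 10,
      p'.2.2 <+: (tribSubst p.2.2).drop j ∧
      tribMat p.2.1 + parikh ((tribSubst p.2.2).take j) = tribBlock (parikh q.1) + p'.2.1 := by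
  decide

lemma exists_blockState (n : ℕ) (u : List (Fin 3)) (c : Fin 3) (hu : u ≠ [])
    (h : u ++ [c] <+: tribSubst^[n] [0]) : ∃ p ∈ blockStates, p.1 = c ∧ HasWindow u p.2.1 p.2.2 := by
  induction n generalizing u c with
  | zero =>
    have := h.length_le
    simp at this
    exact absurd this hu
  | succ n ih =>
    obtain ⟨u', c', s, h1, rfl, h3⟩ := exists_desubstitution h
    by_cases hu' : u' = []
    · subst hu'
      have hc : c' = 0 := by
        have := List.prefix_of_prefix_length_le h1 (tribSubst_iterate_prefix (Nat.zero_le n))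
          (by simp)
        simpa using this
      subst hc
      rcases append_singleton_prefix_tribMorph h3 with ⟨rfl, -⟩ | ⟨rfl, rfl, -⟩ | ⟨-, -, h⟩
      · simp [tribSubst] at hu
      · exact ⟨(1, (-1, 0, 0), [0, 1, 0, 0, 1, 0]), by simp [blockStates], rfl,
          [0, 1, 0, 2], ⟨4, by decide⟩, by decide⟩
      · simp at h
    · obtain ⟨p, hp, rfl, hw⟩ := ih u' c' hu' h1
      have hq : (s, c) ∈ [(([] : List (Fin 3)), (0 : Fin 3)), ([0], 1), ([0], 2)] := by
        rcases append_singleton_prefix_tribMorph h3 with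
          ⟨rfl, rfl⟩ | ⟨rfl, rfl, -⟩ | ⟨rfl, rfl, -⟩ <;> simp
      obtain ⟨p', hp', hc, j, -, hW, hv⟩ := blockStates_step p hp (s, c) hq h3
      exact ⟨p', hp', hc, hw.tribSubst j hW hv⟩

lemma blockStates_parikh_take : ∀ p ∈ blockStates,
    (parikh (p.2.2.take 3) + p.2.1).1 + (parikh (p.2.2.take 3) + p.2.1).2.1 +
      (parikh (p.2.2.take 3) + p.2.1).2.2 = 2 ∧
    ((parikh (p.2.2.take 3) + p.2.1).2.1 = 0 ∨ (parikh (p.2.2.take 3) + p.2.1).2.1 = 1) := by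
  decide

lemma exists_prefix_count_one (k : ℕ) : ∃ w, IsTribPrefix w ∧ w.length + 1 = tribB k ∧
    (w.count 1 + 1 = tribA k ∨ w.count 1 = tribA k) := by
  obtain ⟨c, hc⟩ := exists_tribPrefix_succ k
  have hl := length_tribPrefix k
  rw [length_eq_count] at hl
  by_cases hk : tribPrefix k = []
  · refine ⟨[0, 1], ⟨1, by simp [tribSubst, tribMorph]⟩, ?_⟩
    have hk0 : k = 0 := by simpa [hk] using hl.symm
    subst hk0
    simp [tribA, tribB, hk]
  · obtain ⟨n, hn⟩ := isTribPrefix_tribPrefix (k + 1)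
    rw [hc] at hn
    obtain ⟨p, hp, -, U, hU, hv⟩ := exists_blockState n _ c hk hn
    obtain ⟨h2, h3⟩ := blockStates_parikh_take p hp
    refine ⟨U ++ p.2.2.take 3,
      hU.of_prefix ((List.prefix_append_right_inj _).2 (List.take_prefix _ _)), ?_⟩
    generalize p.2.2.take 3 = T at *
    obtain ⟨c, ⟨v0, v1, v2⟩, W⟩ := p
    rw [length_eq_count]
    simp only [parikh, tribBlock, tribMat, Prod.mk_add_mk, Prod.mk.injEq] at hv h2 h3
    simp only [tribA, tribB, List.count_append]
    omega

/-- For every `n ≥ 1`, either `a_{bₙ} = aₙ + bₙ` or `a_{bₙ} = aₙ + bₙ − 1`. -/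
theorem qdee_coordinate_sums (n : ℕ) (hn : 1 ≤ n) :
    (qdee ((qdee n).2)).1 = (qdee n).1 + (qdee n).2 ∨
    (qdee ((qdee n).2)).1 = (qdee n).1 + (qdee n).2 - 1 := by
  obtain ⟨k, rfl⟩ : ∃ k, n = k + 1 := ⟨n - 1, by omega⟩
  obtain ⟨w, hw, hlen, hcount⟩ := exists_prefix_count_one k
  rw [qdee_succ]
  simp only [← hlen]
  rw [qdee_succ]
  have h : tribA w.length = 1 + w.length + w.count 1 := by rw [tribA, hw.eq_tribPrefix]
  simp only [h]
  omega
end
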